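/- arXiv:1807.03256 — 4 statements merged into one kernel-verified Lean document; each statement's English description precedes it below -/
import Mathlib

section
/- Let A be a d×d real matrix with spectral radius strictly less than 1 (a Schur matrix), let b₁, …, b_L ∈ ℝ^d, and let p₁, …, p_L : ℝ^d → [0,1] be Lipschitz continuous functions with Σ_{ℓ=1}^{L} p_ℓ(x) = 1 for all x and p_ℓ(x) ≥ δ for all x and ℓ, for some δ > 0. Consider the Markov kernel on ℝ^d given by κ(x) = Σ_{ℓ=1}^{L} p_ℓ(x)·δ_{A x + b_ℓ}. Then κ admits a unique invariant probability measure μ, and μ is attractive: for every initial probability measure ν on ℝ^d, the iterates ν_k converge weakly to μ. -/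
open MeasureTheory ProbabilityTheory Filter Topology

/-- The Markov operator `f ↦ ∑ i, p i · f ∘ F i` of an iterated function system with
place-dependent probabilities. -/
def ifsOperator {X ι : Type*} [Fintype ι] (F : ι → X → X) (p : ι → X → ℝ) (f : X → ℝ) (x : X) : ℝ :=
  ∑ i, p i x * f (F i x)

/-- An iterated function system which leaves `B` invariant and on `B` is uniformly contracting for
`ρ`, with probabilities which are bounded below and Lipschitz for `ρ`. -/
structure IsContractiveIFS {X ι : Type*} [Fintype ι] (F : ι → X → X) (p : ι → X → ℝ) (B : Set X)
    (ρ : X → X → ℝ) (δ s K : ℝ) : Prop where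
  delta_nonneg : 0 ≤ δ
  s_nonneg : 0 ≤ s
  s_lt_one : s < 1
  K_nonneg : 0 ≤ K
  rho_nonneg : ∀ x y, 0 ≤ ρ x y
  maps_to : ∀ i, ∀ x ∈ B, F i x ∈ B
  sum_eq_one : ∀ x ∈ B, ∑ i, p i x = 1
  le_prob : ∀ i, ∀ x ∈ B, δ ≤ p i x
  abs_prob_sub_le : ∀ i, ∀ x ∈ B, ∀ y ∈ B, |p i x - p i y| ≤ K * ρ x y
  rho_map_le : ∀ i, ∀ x ∈ B, ∀ y ∈ B, ρ (F i x) (F i y) ≤ s * ρ x y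

/-- On `B`, the function `f` oscillates by at most `O` and is `Λ`-Lipschitz for `ρ`. -/
def OscLipOn {X : Type*} (B : Set X) (ρ : X → X → ℝ) (f : X → ℝ) (O Λ : ℝ) : Prop :=
  ∀ x ∈ B, ∀ y ∈ B, f x - f y ≤ O ∧ f x - f y ≤ Λ * ρ x y

lemma sum_mul_sub_sum_mul_le {ι : Type*} [Fintype ι] [Nonempty ι] {u v α β : ι → ℝ} {W O : ℝ}
    (hu : ∀ i, 0 ≤ u i) (hv : ∀ i, 0 ≤ v i) (hus : ∑ i, u i = W) (hvs : ∑ i, v i = W)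
    (h : ∀ i j, α i - β j ≤ O) : ∑ i, u i * α i - ∑ i, v i * β i ≤ W * O := by
  obtain ⟨j, hj⟩ := Finite.exists_min β
  have h1 : ∑ i, u i * α i ≤ W * (β j + O) := by
    rw [← hus, Finset.sum_mul]
    exact Finset.sum_le_sum fun i _ ↦
      mul_le_mul_of_nonneg_left (by linarith [h i j]) (hu i)
  have h2 : W * β j ≤ ∑ i, v i * β i := by
    rw [← hvs, Finset.sum_mul]
    exact Finset.sum_le_sum fun i _ ↦ mul_le_mul_of_nonneg_left (hj i) (hv i)
  linarith

namespace IsContractiveIFS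

variable {X ι : Type*} [Fintype ι] [Nonempty ι] {F : ι → X → X} {p : ι → X → ℝ} {B : Set X}
  {ρ : X → X → ℝ} {δ s K : ℝ}

omit [Nonempty ι] in
lemma card_mul_delta_le_one (h : IsContractiveIFS F p B ρ δ s K) (hB : B.Nonempty) :
    Fintype.card ι * δ ≤ 1 := by
  obtain ⟨x, hx⟩ := hB
  rw [← h.sum_eq_one x hx]
  simpa using Finset.sum_le_sum fun i (_ : i ∈ Finset.univ) ↦ h.le_prob i x hx

lemma operator_sub_le_coupling (h : IsContractiveIFS F p B ρ δ s K) {f : X → ℝ} {O a e : ℝ}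
    (he : 0 ≤ e) (hO : ∀ x ∈ B, ∀ y ∈ B, f x - f y ≤ O)
    (hf : ∀ x ∈ B, ∀ y ∈ B, f x - f y ≤ a + e * ρ x y) {x y : X} (hx : x ∈ B) (hy : y ∈ B) :
    ifsOperator F p f x - ifsOperator F p f y ≤
      (1 - Fintype.card ι * δ) * O + Fintype.card ι * δ * (a + e * (s * ρ x y)) := by
  have h1 : ∑ i, (p i x - δ) * f (F i x) - ∑ i, (p i y - δ) * f (F i y) ≤
      (1 - Fintype.card ι * δ) * O := by
    refine sum_mul_sub_sum_mul_le (fun i ↦ sub_nonneg.2 (h.le_prob i x hx))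
      (fun i ↦ sub_nonneg.2 (h.le_prob i y hy)) ?_ ?_
      (fun i j ↦ hO _ (h.maps_to i x hx) _ (h.maps_to j y hy))
    · simp [Finset.sum_sub_distrib, h.sum_eq_one x hx]
    · simp [Finset.sum_sub_distrib, h.sum_eq_one y hy]
  have h2 : ∑ i, δ * (f (F i x) - f (F i y)) ≤ ∑ _i : ι, δ * (a + e * (s * ρ x y)) :=
    Finset.sum_le_sum fun i _ ↦ mul_le_mul_of_nonneg_left
      ((hf _ (h.maps_to i x hx) _ (h.maps_to i y hy)).trans
        (by gcongr; exact h.rho_map_le i x hx y hy)) h.delta_nonneg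
  have h3 : ifsOperator F p f x - ifsOperator F p f y =
      (∑ i, (p i x - δ) * f (F i x) - ∑ i, (p i y - δ) * f (F i y)) +
        ∑ i, δ * (f (F i x) - f (F i y)) := by
    simp only [ifsOperator, ← Finset.sum_sub_distrib, ← Finset.sum_add_distrib]
    exact Finset.sum_congr rfl fun i _ ↦ by ring
  simp only [Finset.sum_const, Finset.card_univ, nsmul_eq_mul] at h2
  linarith

lemma operator_sub_le_osc (h : IsContractiveIFS F p B ρ δ s K) {f : X → ℝ} {O : ℝ}
    (hO : ∀ x ∈ B, ∀ y ∈ B, f x - f y ≤ O) {x y : X} (hx : x ∈ B) (hy : y ∈ B) :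
    ifsOperator F p f x - ifsOperator F p f y ≤ O := by
  have := h.operator_sub_le_coupling (e := 0) le_rfl hO (a := O) (by simpa using hO) hx hy
  linarith

omit [Nonempty ι] in
lemma operator_sub_le_lip (h : IsContractiveIFS F p B ρ δ s K) {f : X → ℝ} {O Λ : ℝ} (hΛ : 0 ≤ Λ)
    (hf : OscLipOn B ρ f O Λ) {x y : X} (hx : x ∈ B) (hy : y ∈ B) :
    ifsOperator F p f x - ifsOperator F p f y ≤ (s * Λ + Fintype.card ι * K * O) * ρ x y := by
  have h1 : ∑ i, p i x * (f (F i x) - f (F i y)) ≤ ∑ i, p i x * (Λ * (s * ρ x y)) :=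
    Finset.sum_le_sum fun i _ ↦ mul_le_mul_of_nonneg_left
      ((hf _ (h.maps_to i x hx) _ (h.maps_to i y hy)).2.trans
        (by gcongr; exact h.rho_map_le i x hx y hy)) (h.delta_nonneg.trans (h.le_prob i x hx))
  have h2 : ∑ i, (p i x - p i y) * (f (F i y) - f y) ≤ ∑ _i : ι, K * ρ x y * O := by
    refine Finset.sum_le_sum fun i _ ↦ (le_abs_self _).trans ?_
    rw [abs_mul]
    refine mul_le_mul (h.abs_prob_sub_le i x hx y hy) ?_ (abs_nonneg _)
      (mul_nonneg h.K_nonneg (h.rho_nonneg x y))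
    have := (hf _ (h.maps_to i y hy) y hy).1
    have := (hf y hy _ (h.maps_to i y hy)).1
    exact abs_le.2 ⟨by linarith, by linarith⟩
  have h3 : ifsOperator F p f x - ifsOperator F p f y =
      ∑ i, p i x * (f (F i x) - f (F i y)) + ∑ i, (p i x - p i y) * (f (F i y) - f y) := by
    have : ∑ i, (p i x - p i y) * f y = 0 := by
      rw [← Finset.sum_mul, Finset.sum_sub_distrib, h.sum_eq_one x hx, h.sum_eq_one y hy]; simp
    rw [← add_zero (_ + _), ← this]
    simp only [ifsOperator, ← Finset.sum_sub_distrib, ← Finset.sum_add_distrib]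
    exact Finset.sum_congr rfl fun i _ ↦ by ring
  rw [← Finset.sum_mul, h.sum_eq_one x hx] at h1
  simp only [Finset.sum_const, Finset.card_univ, nsmul_eq_mul] at h2
  linarith

lemma operator_iterate_sub_le_osc (h : IsContractiveIFS F p B ρ δ s K) {f : X → ℝ} {O : ℝ}
    (hO : ∀ x ∈ B, ∀ y ∈ B, f x - f y ≤ O) (n : ℕ) :
    ∀ x ∈ B, ∀ y ∈ B, (ifsOperator F p)^[n] f x - (ifsOperator F p)^[n] f y ≤ O := by
  induction n with
  | zero => exact hO
  | succ n ih =>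
    intro x hx y hy
    rw [Function.iterate_succ_apply']
    exact h.operator_sub_le_osc ih hx hy

lemma operator_iterate_sub_le_coupling (h : IsContractiveIFS F p B ρ δ s K) {f : X → ℝ} {O Λ : ℝ}
    (hΛ : 0 ≤ Λ) (hf : OscLipOn B ρ f O Λ) (n : ℕ) :
    ∀ x ∈ B, ∀ y ∈ B, (ifsOperator F p)^[n] f x - (ifsOperator F p)^[n] f y ≤
      (1 - (Fintype.card ι * δ) ^ n) * O + ((Fintype.card ι * δ) ^ n * s ^ n * Λ) * ρ x y := by
  have hδ := h.delta_nonneg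
  have hs := h.s_nonneg
  induction n with
  | zero => intro x hx y hy; simpa using (hf x hx y hy).2
  | succ n ih =>
    intro x hx y hy
    rw [Function.iterate_succ_apply']
    refine (h.operator_sub_le_coupling (by positivity)
      (h.operator_iterate_sub_le_osc (fun x hx y hy ↦ (hf x hx y hy).1) n) ih hx hy).trans ?_
    apply le_of_eq
    ring

lemma operator_iterate_sub_le_lip (h : IsContractiveIFS F p B ρ δ s K) {f : X → ℝ} {O Λ : ℝ}
    (hO : 0 ≤ O) (hΛ : 0 ≤ Λ) (hf : OscLipOn B ρ f O Λ) (n : ℕ) :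
    ∀ x ∈ B, ∀ y ∈ B, (ifsOperator F p)^[n] f x - (ifsOperator F p)^[n] f y ≤
      (s ^ n * Λ + Fintype.card ι * K / (1 - s) * O) * ρ x y := by
  have hs := h.s_nonneg
  have hs' : 0 < 1 - s := sub_pos.2 h.s_lt_one
  have hK := h.K_nonneg
  induction n with
  | zero =>
    intro x hx y hy
    refine (hf x hx y hy).2.trans (mul_le_mul_of_nonneg_right ?_ (h.rho_nonneg x y))
    have : 0 ≤ Fintype.card ι * K / (1 - s) * O := by positivity
    simpa using this
  | succ n ih =>
    intro x hx y hy
    rw [Function.iterate_succ_apply']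
    refine (h.operator_sub_le_lip (by positivity) (fun x hx y hy ↦
      ⟨h.operator_iterate_sub_le_osc (fun x hx y hy ↦ (hf x hx y hy).1) n x hx y hy,
        ih x hx y hy⟩) hx hy).trans (le_of_eq ?_)
    field_simp
    ring

lemma exists_contraction (h : IsContractiveIFS F p B ρ δ s K) (hδ : 0 < δ) (hB : B.Nonempty)
    {D : ℝ} (hD : ∀ x ∈ B, ∀ y ∈ B, ρ x y ≤ D) :
    ∃ n : ℕ, ∃ a > 0, ∃ θ : ℝ, 0 ≤ θ ∧ θ < 1 ∧ ∀ f O Λ, 0 ≤ O → 0 ≤ Λ → OscLipOn B ρ f O Λ →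
      ∃ O' Λ', 0 ≤ O' ∧ 0 ≤ Λ' ∧ OscLipOn B ρ ((ifsOperator F p)^[n] f) O' Λ' ∧
        O' + a * Λ' ≤ θ * (O + a * Λ) := by
  have hs := h.s_nonneg
  have hs' : 0 < 1 - s := sub_pos.2 h.s_lt_one
  have hK := h.K_nonneg
  have hm1 := h.card_mul_delta_le_one hB
  have hm0 : 0 < Fintype.card ι * δ := mul_pos (by exact_mod_cast Fintype.card_pos) hδ
  have hD0 : 0 ≤ D := by
    obtain ⟨x, hx⟩ := hB
    exact (h.rho_nonneg x x).trans (hD x hx x hx)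
  -- enlarging the Lipschitz constant makes it positive
  set C : ℝ := Fintype.card ι * K / (1 - s) + 1 with hC
  have hC0 : 0 < C := by positivity
  obtain ⟨n, hn⟩ : ∃ n : ℕ, s ^ n * (2 * C * D + 1) < 1 / 2 := by
    have : Tendsto (fun n : ℕ ↦ s ^ n * (2 * C * D + 1)) atTop (𝓝 (0 * (2 * C * D + 1))) :=
      (tendsto_pow_atTop_nhds_zero_of_lt_one hs h.s_lt_one).mul_const _
    rw [zero_mul] at this
    exact (this.eventually_lt_const (by norm_num)).exists
  set η : ℝ := (Fintype.card ι * δ) ^ n with hη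
  have hη0 : 0 < η := by positivity
  have hη1 : η ≤ 1 := pow_le_one₀ hm0.le hm1
  refine ⟨n, η / (2 * C), by positivity, 1 - η / 2, by linarith, by linarith, ?_⟩
  intro f O Λ hO hΛ hf
  have hsn : 0 ≤ s ^ n := by positivity
  refine ⟨(1 - η) * O + η * s ^ n * Λ * D, s ^ n * Λ + C * O, ?_, by positivity, ?_, ?_⟩
  · have : 0 ≤ 1 - η := by linarith
    positivity
  · intro x hx y hy
    constructor
    · refine (h.operator_iterate_sub_le_coupling hΛ hf n x hx y hy).trans ?_
      gcongr
      exact hD x hx y hy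
    · refine (h.operator_iterate_sub_le_lip hO hΛ hf n x hx y hy).trans
        (mul_le_mul_of_nonneg_right ?_ (h.rho_nonneg x y))
      gcongr
      linarith
  · have key : (1 - η) * O + η * s ^ n * Λ * D + η / (2 * C) * (s ^ n * Λ + C * O) =
        (1 - η / 2) * O + η / (2 * C) * Λ * (s ^ n * (2 * C * D + 1)) := by
      field_simp
      ring
    have hΛ' : 0 ≤ η / (2 * C) * Λ := by positivity
    have h1 := mul_le_mul_of_nonneg_left hn.le hΛ'
    have h2 := mul_le_mul_of_nonneg_right hη1 hΛ'
    rw [key]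
    linarith

lemma exists_iterate_sub_le (h : IsContractiveIFS F p B ρ δ s K) (hδ : 0 < δ) (hB : B.Nonempty)
    {D : ℝ} (hD : ∀ x ∈ B, ∀ y ∈ B, ρ x y ≤ D) {f : X → ℝ} {O Λ : ℝ} (hO : 0 ≤ O) (hΛ : 0 ≤ Λ)
    (hf : OscLipOn B ρ f O Λ) {ε : ℝ} (hε : 0 < ε) :
    ∃ k : ℕ, ∀ j : ℕ, ∀ x ∈ B, ∀ y ∈ B,
      (ifsOperator F p)^[j + k] f x - (ifsOperator F p)^[j + k] f y ≤ ε := by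
  obtain ⟨n, a, ha, θ, hθ0, hθ1, hstep⟩ := h.exists_contraction hδ hB hD
  have hiter : ∀ k : ℕ, ∃ O' Λ', 0 ≤ O' ∧ 0 ≤ Λ' ∧
      OscLipOn B ρ ((ifsOperator F p)^[n * k] f) O' Λ' ∧ O' + a * Λ' ≤ θ ^ k * (O + a * Λ) := by
    intro k
    induction k with
    | zero => exact ⟨O, Λ, hO, hΛ, hf, by simp⟩
    | succ k ih =>
      obtain ⟨O₁, Λ₁, hO₁, hΛ₁, hf₁, hle₁⟩ := ih
      obtain ⟨O₂, Λ₂, hO₂, hΛ₂, hf₂, hle₂⟩ := hstep _ O₁ Λ₁ hO₁ hΛ₁ hf₁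
      refine ⟨O₂, Λ₂, hO₂, hΛ₂, ?_, ?_⟩
      · rwa [Nat.mul_succ, Nat.add_comm, Function.iterate_add_apply]
      · calc _ ≤ θ * (O₁ + a * Λ₁) := hle₂
          _ ≤ θ * (θ ^ k * (O + a * Λ)) := by gcongr
          _ = _ := by ring
  obtain ⟨k, hk⟩ : ∃ k : ℕ, θ ^ k * (O + a * Λ) < ε := by
    have : Tendsto (fun k : ℕ ↦ θ ^ k * (O + a * Λ)) atTop (𝓝 (0 * (O + a * Λ))) :=
      (tendsto_pow_atTop_nhds_zero_of_lt_one hθ0 hθ1).mul_const _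
    rw [zero_mul] at this
    exact (this.eventually_lt_const hε).exists
  obtain ⟨O₁, Λ₁, hO₁, hΛ₁, hf₁, hle₁⟩ := hiter k
  refine ⟨n * k, fun j x hx y hy ↦ ?_⟩
  rw [Function.iterate_add_apply]
  refine (h.operator_iterate_sub_le_osc (fun x hx y hy ↦ (hf₁ x hx y hy).1) j x hx y hy).trans ?_
  nlinarith [mul_nonneg ha.le hΛ₁]

omit [Nonempty ι] in
lemma operator_iterate_mem_Icc (h : IsContractiveIFS F p B ρ δ s K) {f : X → ℝ} {m M : ℝ}
    (hf : ∀ x ∈ B, f x ∈ Set.Icc m M) (n : ℕ) :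
    ∀ x ∈ B, (ifsOperator F p)^[n] f x ∈ Set.Icc m M := by
  induction n with
  | zero => exact hf
  | succ n ih =>
    intro x hx
    rw [Function.iterate_succ_apply']
    exact (convex_Icc m M).sum_mem (fun i _ ↦ h.delta_nonneg.trans (h.le_prob i x hx))
      (h.sum_eq_one x hx) (fun i _ ↦ ih _ (h.maps_to i x hx))

lemma cauchySeq_operator_iterate (h : IsContractiveIFS F p B ρ δ s K) (hδ : 0 < δ)
    {D : ℝ} (hD : ∀ x ∈ B, ∀ y ∈ B, ρ x y ≤ D) {f : X → ℝ} {O Λ : ℝ} (hO : 0 ≤ O) (hΛ : 0 ≤ Λ)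
    (hf : OscLipOn B ρ f O Λ) {x : X} (hx : x ∈ B) :
    CauchySeq fun k ↦ (ifsOperator F p)^[k] f x := by
  rw [Metric.cauchySeq_iff']
  intro ε hε
  obtain ⟨k, hk⟩ := h.exists_iterate_sub_le hδ ⟨x, hx⟩ hD hO hΛ hf (half_pos hε)
  refine ⟨k, fun n hn ↦ ?_⟩
  obtain ⟨j, rfl⟩ := Nat.exists_eq_add_of_le hn
  have hk0 := hk 0
  rw [Nat.zero_add] at hk0
  have := h.operator_iterate_mem_Icc (f := (ifsOperator F p)^[k] f)
    (m := (ifsOperator F p)^[k] f x - ε / 2) (M := (ifsOperator F p)^[k] f x + ε / 2)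
    (fun z hz ↦ ⟨by linarith [hk0 x hx z hz], by linarith [hk0 z hz x hx]⟩) j x hx
  rw [← Function.iterate_add_apply, Nat.add_comm] at this
  rw [Real.dist_eq, abs_lt]
  exact ⟨by linarith [this.1], by linarith [this.2]⟩

lemma tendsto_operator_iterate_sub (h : IsContractiveIFS F p B ρ δ s K) (hδ : 0 < δ)
    {D : ℝ} (hD : ∀ x ∈ B, ∀ y ∈ B, ρ x y ≤ D) {f : X → ℝ} {O Λ : ℝ} (hO : 0 ≤ O) (hΛ : 0 ≤ Λ)
    (hf : OscLipOn B ρ f O Λ) {x y : X} (hx : x ∈ B) (hy : y ∈ B) :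
    Tendsto (fun k ↦ (ifsOperator F p)^[k] f x - (ifsOperator F p)^[k] f y) atTop (𝓝 0) := by
  rw [Metric.tendsto_atTop]
  intro ε hε
  obtain ⟨k, hk⟩ := h.exists_iterate_sub_le hδ ⟨x, hx⟩ hD hO hΛ hf (half_pos hε)
  refine ⟨k, fun n hn ↦ ?_⟩
  obtain ⟨j, rfl⟩ := Nat.exists_eq_add_of_le' hn
  rw [Real.dist_eq, sub_zero, abs_lt]
  exact ⟨by linarith [hk j y hy x hx], by linarith [hk j x hx y hy]⟩

end IsContractiveIFS

section AdaptedNorm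

attribute [local instance] Matrix.linftyOpNormedRing Matrix.linftyOpNormedAlgebra

lemma exists_norm_pow_mulVec_le_of_spectrum_lt_one {d : ℕ} (A : Matrix (Fin d) (Fin d) ℝ)
    (hA : ∀ z ∈ spectrum ℂ (A.map (Complex.ofReal ·)), ‖z‖ < 1) :
    ∃ N : ℕ, ∃ s : ℝ, 0 < s ∧ s < 1 ∧ 1 ≤ N ∧
      ∀ x : Fin d → ℝ, ‖(A ^ N).mulVec x‖ ≤ s ^ N * ‖x‖ := by
  rcases Nat.eq_zero_or_pos d with rfl | hd
  · refine ⟨1, 1 / 2, by norm_num, by norm_num, le_rfl, fun x ↦ ?_⟩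
    rw [Subsingleton.elim ((A ^ 1).mulVec x) 0, norm_zero]
    positivity
  have : Nonempty (Fin d) := ⟨⟨0, hd⟩⟩
  set AC : Matrix (Fin d) (Fin d) ℂ := A.map (Complex.ofReal ·) with hAC
  have hrad : spectralRadius ℂ AC < (1 : NNReal) :=
    spectrum.spectralRadius_lt_of_forall_lt AC fun z hz ↦ by
      rw [← NNReal.coe_lt_coe]; simpa using hA z hz
  obtain ⟨r, hr, hr1⟩ := ENNReal.lt_iff_exists_nnreal_btwn.1 hrad
  have hr0 : 0 < r := by
    rw [← ENNReal.coe_pos]; exact zero_le.trans_lt hr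
  obtain ⟨N, hN, hN1⟩ := (((spectrum.pow_nnnorm_pow_one_div_tendsto_nhds_spectralRadius
    AC).eventually_lt_const hr).and (eventually_ge_atTop 1)).exists
  refine ⟨N, r, hr0, by exact_mod_cast hr1, hN1, fun x ↦ ?_⟩
  have hpow : ‖AC ^ N‖ ≤ (r : ℝ) ^ N := by
    have h1 : (‖AC ^ N‖₊ : ENNReal) ≤ (r : ENNReal) ^ N := by
      have h2 := ENNReal.rpow_le_rpow hN.le (Nat.cast_nonneg (α := ℝ) N)
      rw [← ENNReal.rpow_mul, one_div, inv_mul_cancel₀ (by positivity), ENNReal.rpow_one,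
        ENNReal.rpow_natCast] at h2
      exact h2
    exact_mod_cast h1
  have hmap : AC ^ N = (A ^ N).map (Complex.ofReal ·) :=
    (map_pow (Complex.ofRealHom.mapMatrix (m := Fin d)) A N).symm
  have hnorm : ‖AC ^ N‖ = ‖A ^ N‖ := by
    rw [hmap, Matrix.linfty_opNorm_def, Matrix.linfty_opNorm_def]
    simp
  calc ‖(A ^ N).mulVec x‖ ≤ ‖A ^ N‖ * ‖x‖ := Matrix.linfty_opNorm_mulVec _ _
    _ ≤ _ := by rw [← hnorm]; gcongr

lemma exists_seminorm_mulVec_le {d : ℕ} (A : Matrix (Fin d) (Fin d) ℝ)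
    (hA : ∀ z ∈ spectrum ℂ (A.map (Complex.ofReal ·)), ‖z‖ < 1) :
    ∃ V : Seminorm ℝ (Fin d → ℝ), ∃ s : ℝ, 0 ≤ s ∧ s < 1 ∧ (∀ x, V (A.mulVec x) ≤ s * V x) ∧
      (∀ x, ‖x‖ ≤ V x) ∧ Continuous V := by
  obtain ⟨N, s, hs0, hs1, hN, hle⟩ := exists_norm_pow_mulVec_le_of_spectrum_lt_one A hA
  let V : Seminorm ℝ (Fin d → ℝ) :=
    Seminorm.of (fun x ↦ ∑ k ∈ Finset.range N, (s ^ k)⁻¹ * ‖(A ^ k).mulVec x‖)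
      (fun x y ↦ by
        rw [← Finset.sum_add_distrib]
        refine Finset.sum_le_sum fun k _ ↦ ?_
        rw [Matrix.mulVec_add, ← mul_add]
        gcongr
        exact norm_add_le _ _)
      (fun c x ↦ by
        rw [Finset.mul_sum]
        refine Finset.sum_congr rfl fun k _ ↦ ?_
        rw [Matrix.mulVec_smul, norm_smul]
        ring)
  have hV : ∀ x, V x = ∑ k ∈ Finset.range N, (s ^ k)⁻¹ * ‖(A ^ k).mulVec x‖ := fun _ ↦ rfl
  refine ⟨V, s, hs0.le, hs1, fun x ↦ ?_, fun x ↦ ?_, ?_⟩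
  · have hshift : V (A.mulVec x) =
        s * ∑ k ∈ Finset.range N, (s ^ (k + 1))⁻¹ * ‖(A ^ (k + 1)).mulVec x‖ := by
      rw [hV, Finset.mul_sum]
      refine Finset.sum_congr rfl fun k _ ↦ ?_
      rw [Matrix.mulVec_mulVec, ← pow_succ]
      field_simp
      ring
    rw [hshift, hV]
    refine mul_le_mul_of_nonneg_left ?_ hs0.le
    have h1 := Finset.sum_range_succ (fun k ↦ (s ^ k)⁻¹ * ‖(A ^ k).mulVec x‖) N
    rw [Finset.sum_range_succ'] at h1
    have h2 : (s ^ N)⁻¹ * ‖(A ^ N).mulVec x‖ ≤ ‖x‖ := by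
      rw [inv_mul_le_iff₀ (by positivity)]
      exact hle x
    simp only [pow_zero, inv_one, Matrix.one_mulVec, one_mul] at h1
    linarith
  · rw [hV]
    have := Finset.single_le_sum (f := fun k ↦ (s ^ k)⁻¹ * ‖(A ^ k).mulVec x‖)
      (fun k _ ↦ by positivity) (Finset.mem_range.2 hN)
    simpa using this
  · rw [funext hV]
    exact continuous_finsetSum _ fun k _ ↦
      continuous_const.mul (A ^ k).mulVecLin.continuous_of_finiteDimensional.norm

end AdaptedNorm

/-- The closed balls of a seminorm which is contracted by the linear part of an affine iterated
function system carry a contractive system as soon as they are large enough. -/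
lemma isContractiveIFS_affine {E ι : Type*} [NormedAddCommGroup E] [NormedSpace ℝ E] [Fintype ι]
    {T : E →ₗ[ℝ] E} {b : ι → E} {p : ι → E → ℝ} {δ s R : ℝ} {K : NNReal} (V : Seminorm ℝ E)
    (hδ : 0 ≤ δ) (hs : 0 ≤ s) (hs1 : s < 1) (hT : ∀ x, V (T x) ≤ s * V x)
    (hV : ∀ x, ‖x‖ ≤ V x) (hR : ∀ i, V (b i) ≤ (1 - s) * R)
    (hp : ∀ i, LipschitzWith K (p i)) (hpsum : ∀ x, ∑ i, p i x = 1) (hpδ : ∀ i x, δ ≤ p i x) :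
    IsContractiveIFS (fun i x ↦ T x + b i) p {x | V x ≤ R} (fun x y ↦ V (x - y)) δ s K where
  delta_nonneg := hδ
  s_nonneg := hs
  s_lt_one := hs1
  K_nonneg := K.2
  rho_nonneg _ _ := apply_nonneg V _
  maps_to i x (hx : V x ≤ R) := by
    have h1 := map_add_le_add V (T x) (b i)
    have h2 := mul_le_mul_of_nonneg_left hx hs
    have h3 := hT x
    have h4 := hR i
    change V (T x + b i) ≤ R
    linarith
  sum_eq_one x _ := hpsum x
  le_prob i x _ := hpδ i x
  abs_prob_sub_le i x _ y _ := by
    rw [← Real.dist_eq]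
    refine ((hp i).dist_le_mul x y).trans ?_
    rw [dist_eq_norm]
    gcongr
    exact hV _
  rho_map_le i x _ y _ := by
    simpa [← map_sub] using hT (x - y)

section Kernel

variable {E ι : Type*} [MeasurableSpace E] [Fintype ι] {F : ι → E → E} {p : ι → E → ℝ}
  {κ : Kernel E E}

lemma isMarkovKernel_of_eq_sum_dirac (hp0 : ∀ i x, 0 ≤ p i x) (hpsum : ∀ x, ∑ i, p i x = 1)
    (hκ : ∀ x, κ x = ∑ i, ENNReal.ofReal (p i x) • Measure.dirac (F i x)) : IsMarkovKernel κ := by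
  refine ⟨fun x ↦ ⟨?_⟩⟩
  rw [hκ]
  simp [← ENNReal.ofReal_sum_of_nonneg fun i _ ↦ hp0 i x, hpsum]

lemma integral_eq_ifsOperator [MeasurableSingletonClass E] (hp0 : ∀ i x, 0 ≤ p i x)
    (hκ : ∀ x, κ x = ∑ i, ENNReal.ofReal (p i x) • Measure.dirac (F i x)) (f : E → ℝ) (x : E) :
    ∫ y, f y ∂(κ x) = ifsOperator F p f x := by
  rw [hκ, integral_finsetSum_measure]
  · simp [ifsOperator, integral_smul_measure, ENNReal.toReal_ofReal (hp0 _ _)]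
  · intro i _
    exact (integrable_dirac (by simp)).smul_measure ENNReal.ofReal_ne_top

lemma integral_bind_of_bounded (μ : Measure E) [IsProbabilityMeasure μ] [IsMarkovKernel κ]
    {f : E → ℝ} (hf : Measurable f) {C : ℝ} (hC : ∀ x, |f x| ≤ C) :
    ∫ x, f x ∂(μ.bind κ) = ∫ x, ∫ y, f y ∂(κ x) ∂μ := by
  have hint : Integrable f (μ.bind κ) :=
    Integrable.of_bound hf.aestronglyMeasurable C (ae_of_all _ hC)
  rw [Measure.comp_eq_comp_const_apply] at hint ⊢
  rw [Kernel.integral_comp hint, Kernel.const_apply]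

lemma bind_compl_eq_zero {B : Set E} (hB : MeasurableSet B) (hmaps : ∀ i, ∀ x ∈ B, F i x ∈ B)
    (hκ : ∀ x, κ x = ∑ i, ENNReal.ofReal (p i x) • Measure.dirac (F i x))
    {μ : Measure E} (hμ : μ Bᶜ = 0) : μ.bind κ Bᶜ = 0 := by
  rw [Measure.bind_apply hB.compl κ.aemeasurable, lintegral_eq_zero_iff (κ.measurable_coe hB.compl)]
  have : ∀ᵐ x ∂μ, x ∈ B := hμ
  filter_upwards [this] with x hx
  simp [hκ, Measure.dirac_apply' _ hB.compl, hmaps _ x hx]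

end Kernel

section Operator

variable {E ι : Type*} [Fintype ι] {F : ι → E → E} {p : ι → E → ℝ}

lemma abs_ifsOperator_le (hp0 : ∀ i x, 0 ≤ p i x) (hpsum : ∀ x, ∑ i, p i x = 1) {f : E → ℝ}
    {C : ℝ} (hf : ∀ x, |f x| ≤ C) (x : E) : |ifsOperator F p f x| ≤ C := by
  refine (Finset.abs_sum_le_sum_abs _ _).trans ?_
  calc ∑ i, |p i x * f (F i x)| ≤ ∑ i, p i x * C := by
        refine Finset.sum_le_sum fun i _ ↦ ?_
        rw [abs_mul, abs_of_nonneg (hp0 i x)]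
        exact mul_le_mul_of_nonneg_left (hf _) (hp0 i x)
    _ = C := by rw [← Finset.sum_mul, hpsum, one_mul]

lemma continuous_ifsOperator [TopologicalSpace E] (hF : ∀ i, Continuous (F i))
    (hp : ∀ i, Continuous (p i)) {f : E → ℝ} (hf : Continuous f) :
    Continuous (ifsOperator F p f) :=
  continuous_finsetSum _ fun i _ ↦ (hp i).mul (hf.comp (hF i))

lemma abs_ifsOperator_iterate_le (hp0 : ∀ i x, 0 ≤ p i x) (hpsum : ∀ x, ∑ i, p i x = 1)
    {f : E → ℝ} {C : ℝ} (hf : ∀ x, |f x| ≤ C) (k : ℕ) :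
    ∀ x, |(ifsOperator F p)^[k] f x| ≤ C := by
  induction k with
  | zero => exact hf
  | succ k ih =>
    rw [Function.iterate_succ_apply']
    exact abs_ifsOperator_le hp0 hpsum ih

lemma continuous_ifsOperator_iterate [TopologicalSpace E] (hF : ∀ i, Continuous (F i))
    (hp : ∀ i, Continuous (p i)) {f : E → ℝ} (hf : Continuous f) (k : ℕ) :
    Continuous ((ifsOperator F p)^[k] f) := by
  induction k with
  | zero => exact hf
  | succ k ih =>
    rw [Function.iterate_succ_apply']
    exact continuous_ifsOperator hF hp ih

end Operator

section Affine

variable {E ι : Type*} [NormedAddCommGroup E] [NormedSpace ℝ E] [Fintype ι] [Nonempty ι]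
  {T : E →ₗ[ℝ] E} {b : ι → E} {p : ι → E → ℝ} {δ s : ℝ} {K : NNReal}

lemma exists_tendsto_ifsOperator_iterate_affine (V : Seminorm ℝ E)
    (hδ : 0 < δ) (hs : 0 ≤ s) (hs1 : s < 1) (hT : ∀ x, V (T x) ≤ s * V x)
    (hV : ∀ x, ‖x‖ ≤ V x) (hp : ∀ i, LipschitzWith K (p i)) (hpsum : ∀ x, ∑ i, p i x = 1)
    (hpδ : ∀ i x, δ ≤ p i x) {f : E → ℝ} {C : ℝ} (hC : ∀ x y, dist (f x) (f y) ≤ C) {Λ : NNReal}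
    (hΛ : LipschitzWith Λ f) :
    ∃ c, ∀ x, Tendsto (fun k ↦ (ifsOperator (fun i x ↦ T x + b i) p)^[k] f x) atTop (𝓝 c) := by
  have hs' : 0 < 1 - s := sub_pos.2 hs1
  set R₀ : ℝ := (∑ i, V (b i)) / (1 - s) with hR₀
  have hR₀0 : 0 ≤ R₀ := div_nonneg (Finset.sum_nonneg fun i _ ↦ apply_nonneg V _) hs'.le
  have hbR₀ : ∀ i, V (b i) ≤ (1 - s) * R₀ := fun i ↦ by
    rw [hR₀, mul_div_cancel₀ _ hs'.ne']
    exact Finset.single_le_sum (f := fun i ↦ V (b i)) (fun i _ ↦ apply_nonneg V _)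
      (Finset.mem_univ i)
  have hifs : ∀ R, R₀ ≤ R → IsContractiveIFS (fun i x ↦ T x + b i) p {x | V x ≤ R}
      (fun x y ↦ V (x - y)) δ s K := fun R hR ↦
    isContractiveIFS_affine V hδ.le hs hs1 hT hV
      (fun i ↦ (hbR₀ i).trans (mul_le_mul_of_nonneg_left hR hs'.le)) hp hpsum hpδ
  have hD : ∀ R : ℝ, ∀ x ∈ {x | V x ≤ R}, ∀ y ∈ {x | V x ≤ R}, V (x - y) ≤ 2 * R :=
    fun R x (hx : V x ≤ R) y (hy : V y ≤ R) ↦ by linarith [map_sub_le_add V x y]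
  have hC0 : 0 ≤ C := dist_nonneg.trans (hC 0 0)
  have hf : ∀ R : ℝ, OscLipOn {x | V x ≤ R} (fun x y ↦ V (x - y)) f C Λ := by
    intro R x _ y _
    refine ⟨(le_abs_self _).trans (hC x y), (le_abs_self _).trans ?_⟩
    rw [← Real.dist_eq]
    refine (hΛ.dist_le_mul x y).trans ?_
    rw [dist_eq_norm]
    gcongr
    exact hV _
  obtain ⟨c, hc⟩ := cauchySeq_tendsto_of_complete
    ((hifs R₀ le_rfl).cauchySeq_operator_iterate hδ (hD R₀) hC0 Λ.2 (hf R₀)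
      (x := 0) (by simpa using hR₀0))
  refine ⟨c, fun x ↦ ?_⟩
  have hdiff := (hifs (max R₀ (V x)) (le_max_left _ _)).tendsto_operator_iterate_sub hδ
    (hD _) hC0 Λ.2 (hf _) (x := x) (y := 0) (by simp) (by simp [hR₀0])
  simpa using hdiff.add hc

end Affine

section Attractive

variable {E ι : Type*} [MeasurableSpace E] [Fintype ι] {F : ι → E → E} {p : ι → E → ℝ}
  {κ : Kernel E E}

lemma isProbabilityMeasure_of_succ_eq_bind [IsMarkovKernel κ] {ν : ℕ → Measure E}
    (h0 : IsProbabilityMeasure (ν 0)) (hν : ∀ k, ν (k + 1) = (ν k).bind κ) (k : ℕ) :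
    IsProbabilityMeasure (ν k) := by
  induction k with
  | zero => exact h0
  | succ k ih => rw [hν]; infer_instance

variable [MetricSpace E] [BorelSpace E]

lemma integral_eq_integral_ifsOperator_iterate (hF : ∀ i, Continuous (F i))
    (hp : ∀ i, Continuous (p i)) (hp0 : ∀ i x, 0 ≤ p i x) (hpsum : ∀ x, ∑ i, p i x = 1)
    (hκ : ∀ x, κ x = ∑ i, ENNReal.ofReal (p i x) • Measure.dirac (F i x)) {ν : ℕ → Measure E}
    (h0 : IsProbabilityMeasure (ν 0)) (hν : ∀ k, ν (k + 1) = (ν k).bind κ) (k : ℕ) :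
    ∀ {f : E → ℝ} {C : ℝ}, Continuous f → (∀ x, |f x| ≤ C) →
      ∫ x, f x ∂(ν k) = ∫ x, (ifsOperator F p)^[k] f x ∂(ν 0) := by
  have := isMarkovKernel_of_eq_sum_dirac hp0 hpsum hκ
  induction k with
  | zero => intros; rfl
  | succ k ih =>
    intro f C hf hC
    have := isProbabilityMeasure_of_succ_eq_bind h0 hν k
    rw [hν, integral_bind_of_bounded _ hf.measurable hC, Function.iterate_succ_apply]
    simp_rw [integral_eq_ifsOperator hp0 hκ]
    exact ih (continuous_ifsOperator hF hp hf) (abs_ifsOperator_le hp0 hpsum hC)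

/-- If the iterates of the Markov operator on bounded Lipschitz functions converge pointwise to
constants and some nonempty compact set is invariant, then there is a unique invariant probability
measure, and it is attractive. -/
theorem exists_unique_attractive_of_tendsto_ifsOperator_iterate (hF : ∀ i, Continuous (F i))
    (hp : ∀ i, Continuous (p i)) (hp0 : ∀ i x, 0 ≤ p i x) (hpsum : ∀ x, ∑ i, p i x = 1)
    (hκ : ∀ x, κ x = ∑ i, ENNReal.ofReal (p i x) • Measure.dirac (F i x))
    {B : Set E} (hB : IsCompact B) (hBne : B.Nonempty) (hmaps : ∀ i, ∀ x ∈ B, F i x ∈ B)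
    (hlim : ∀ f : E → ℝ, (∃ C : ℝ, ∀ x y, dist (f x) (f y) ≤ C) → (∃ Λ, LipschitzWith Λ f) →
      ∃ c, ∀ x, Tendsto (fun k ↦ (ifsOperator F p)^[k] f x) atTop (𝓝 c)) :
    ∃ μ : Measure E, IsProbabilityMeasure μ ∧ Kernel.Invariant κ μ ∧
      (∀ μ' : Measure E, IsProbabilityMeasure μ' → Kernel.Invariant κ μ' → μ' = μ) ∧
      (∀ ν : Measure E, IsProbabilityMeasure ν →
        ∀ νiter : ℕ → Measure E, νiter 0 = ν →
          (∀ k, νiter (k + 1) = (νiter k).bind κ) →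
          ∀ g : BoundedContinuousFunction E ℝ,
            Tendsto (fun k => ∫ x, g x ∂(νiter k)) atTop (𝓝 (∫ x, g x ∂μ))) := by
  have := isMarkovKernel_of_eq_sum_dirac hp0 hpsum hκ
  obtain ⟨x₀, hx₀⟩ := hBne
  have hbdd : ∀ {f : E → ℝ}, (∃ C : ℝ, ∀ x y, dist (f x) (f y) ≤ C) → ∃ C, ∀ x, |f x| ≤ C := by
    rintro f ⟨C, hC⟩
    refine ⟨C + |f x₀|, fun x ↦ ?_⟩
    have h1 := hC x x₀
    rw [Real.dist_eq] at h1
    linarith [abs_sub_abs_le_abs_sub (f x) (f x₀)]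
  -- along every trajectory the integrals of bounded Lipschitz functions converge
  have hconv : ∀ ν : ℕ → Measure E, IsProbabilityMeasure (ν 0) →
      (∀ k, ν (k + 1) = (ν k).bind κ) → ∀ f : E → ℝ,
      (∃ C : ℝ, ∀ x y, dist (f x) (f y) ≤ C) → (∃ Λ, LipschitzWith Λ f) → ∀ c,
      (∀ x, Tendsto (fun k ↦ (ifsOperator F p)^[k] f x) atTop (𝓝 c)) →
      Tendsto (fun k ↦ ∫ x, f x ∂(ν k)) atTop (𝓝 c) := by
    intro ν h0 hν f hfb ⟨Λ, hΛ⟩ c hc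
    obtain ⟨C, hC⟩ := hbdd hfb
    simp_rw [fun k ↦ integral_eq_integral_ifsOperator_iterate hF hp hp0 hpsum hκ h0 hν k
      hΛ.continuous hC]
    have := tendsto_integral_of_dominated_convergence (μ := ν 0)
      (F := fun k x ↦ (ifsOperator F p)^[k] f x) (f := fun _ ↦ c) (fun _ ↦ C)
      (fun k ↦ (continuous_ifsOperator_iterate hF hp hΛ.continuous k).measurable.aestronglyMeasurable)
      (integrable_const C)
      (fun k ↦ ae_of_all _ fun x ↦ abs_ifsOperator_iterate_le hp0 hpsum hC k x)
      (ae_of_all _ hc)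
    simpa using this
  set ν₀ : ℕ → Measure E := fun k ↦ (fun μ : Measure E ↦ μ.bind κ)^[k] (Measure.dirac x₀) with hν₀
  have hν₀0 : IsProbabilityMeasure (ν₀ 0) := inferInstanceAs (IsProbabilityMeasure (.dirac x₀))
  have hν₀succ : ∀ k, ν₀ (k + 1) = (ν₀ k).bind κ := fun k ↦ Function.iterate_succ_apply' _ _ _
  have hν₀p := isProbabilityMeasure_of_succ_eq_bind hν₀0 hν₀succ
  have hν₀B : ∀ k, ν₀ k Bᶜ = 0 := by
    intro k
    induction k with
    | zero => simp [hν₀, Measure.dirac_apply' _ hB.measurableSet.compl, hx₀]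
    | succ k ih => rw [hν₀succ]; exact bind_compl_eq_zero hB.measurableSet hmaps hκ ih
  let νP : ℕ → ProbabilityMeasure E := fun k ↦ ⟨ν₀ k, hν₀p k⟩
  have htight : IsTightMeasureSet
      {((μ : ProbabilityMeasure E) : Measure E) | μ ∈ Set.range νP} := by
    rw [isTightMeasureSet_iff_exists_isCompact_measure_compl_le]
    intro ε _
    refine ⟨B, hB, ?_⟩
    rintro _ ⟨_, ⟨k, rfl⟩, rfl⟩
    exact (hν₀B k).le.trans zero_le
  obtain ⟨μ, -, hμ⟩ := (isCompact_closure_of_isTightMeasureSet htight).exists_mapClusterPt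
    (f := atTop) (u := νP) (by
      rw [Filter.le_principal_iff]
      exact Filter.mem_map.2 (univ_mem' fun k ↦ subset_closure ⟨k, rfl⟩))
  obtain ⟨U, hU, hUμ⟩ := mapClusterPt_iff_ultrafilter.1 hμ
  have hμlim : ∀ f : E → ℝ, (∃ C : ℝ, ∀ x y, dist (f x) (f y) ≤ C) →
      (∃ Λ, LipschitzWith Λ f) → ∀ c,
      (∀ x, Tendsto (fun k ↦ (ifsOperator F p)^[k] f x) atTop (𝓝 c)) →
      ∫ x, f x ∂(μ : Measure E) = c := by
    intro f hfb hfL c hc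
    obtain ⟨C, hC⟩ := hbdd hfb
    let g := BoundedContinuousFunction.ofNormedAddCommGroup f hfL.choose_spec.continuous C hC
    exact tendsto_nhds_unique
      (ProbabilityMeasure.tendsto_iff_forall_integral_tendsto.1 hUμ g)
      ((hconv ν₀ hν₀0 hν₀succ f hfb hfL c hc).mono_left hU)
  have hattr : ∀ ν : ℕ → Measure E, IsProbabilityMeasure (ν 0) →
      (∀ k, ν (k + 1) = (ν k).bind κ) → ∀ g : BoundedContinuousFunction E ℝ,
      Tendsto (fun k ↦ ∫ x, g x ∂(ν k)) atTop (𝓝 (∫ x, g x ∂(μ : Measure E))) := by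
    intro ν h0 hν
    have hνp := isProbabilityMeasure_of_succ_eq_bind h0 hν
    refine ProbabilityMeasure.tendsto_iff_forall_integral_tendsto.1
      (tendsto_iff_forall_lipschitz_integral_tendsto
        (μs := fun k ↦ (⟨ν k, hνp k⟩ : ProbabilityMeasure E)).2 ?_)
    intro f hfb hfL
    obtain ⟨c, hc⟩ := hlim f hfb hfL
    rw [hμlim f hfb hfL c hc]
    exact hconv ν h0 hν f hfb hfL c hc
  refine ⟨μ, inferInstance, ?_, ?_, ?_⟩
  · refine ext_of_forall_integral_eq_of_IsFiniteMeasure fun g ↦ ?_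
    have hgC : ∀ x, |g x| ≤ ‖g‖ := g.norm_coe_le_norm
    let Pg := BoundedContinuousFunction.ofNormedAddCommGroup (ifsOperator F p g)
      (continuous_ifsOperator hF hp g.continuous) ‖g‖ (abs_ifsOperator_le hp0 hpsum hgC)
    have hbind : ∀ (m : Measure E) [IsProbabilityMeasure m],
        ∫ x, g x ∂(m.bind κ) = ∫ x, Pg x ∂m := by
      intro m _
      rw [integral_bind_of_bounded m g.continuous.measurable hgC]
      simp_rw [integral_eq_ifsOperator hp0 hκ]
      rfl
    rw [hbind]
    refine tendsto_nhds_unique (hattr ν₀ hν₀0 hν₀succ Pg) ?_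
    have := (hattr ν₀ hν₀0 hν₀succ g).comp (tendsto_add_atTop_nat 1)
    refine this.congr fun k ↦ ?_
    have := hν₀p k
    simp only [Function.comp_apply]
    rw [hν₀succ, hbind]
  · intro μ' hμ' hinv
    refine ext_of_forall_integral_eq_of_IsFiniteMeasure fun g ↦ ?_
    exact tendsto_nhds_unique tendsto_const_nhds
      (hattr (fun _ ↦ μ') hμ' (fun _ ↦ hinv.symm) g)
  · rintro ν hν νiter rfl hsucc g
    exact hattr νiter hν hsucc g

end Attractive


/-- **Affine IFS with Schur linear part and place-dependent probabilities bounded below: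
unique attractive invariant measure** (the paper's Theorem 4).
Let `A` be a `d×d` Schur matrix (spectral radius `< 1`), `b₁, …, b_L ∈ ℝ^d`, and let
`p₁, …, p_L` be Lipschitz probability functions bounded below by `δ > 0`. Then the Markov
kernel `κ(x) = Σ_ℓ p_ℓ(x) • δ_{Ax + b_ℓ}` admits a unique invariant probability measure `μ`,
which is attractive: the iterates of every initial probability measure converge weakly
to `μ`. -/
theorem affine_IFS_unique_attractive_invariant_measure (d L : ℕ) (hL : 1 ≤ L)
    (A : Matrix (Fin d) (Fin d) ℝ)
    (hA : ∀ z ∈ spectrum ℂ (A.map (Complex.ofReal ·)), ‖z‖ < 1)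
    (b : Fin L → (Fin d → ℝ))
    (p : Fin L → (Fin d → ℝ) → ℝ) (δ : ℝ) (hδ : 0 < δ)
    (hplip : ∀ ℓ, ∃ K : NNReal, LipschitzWith K (p ℓ))
    (hp01 : ∀ ℓ x, p ℓ x ∈ Set.Icc (0 : ℝ) 1)
    (hpsum : ∀ x, ∑ ℓ, p ℓ x = 1)
    (hpδ : ∀ ℓ x, δ ≤ p ℓ x)
    (κ : Kernel (Fin d → ℝ) (Fin d → ℝ))
    (hκ : ∀ x, κ x = ∑ ℓ, ENNReal.ofReal (p ℓ x) • Measure.dirac (A.mulVec x + b ℓ)) :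
    ∃ μ : Measure (Fin d → ℝ), IsProbabilityMeasure μ ∧ Kernel.Invariant κ μ ∧
      (∀ μ' : Measure (Fin d → ℝ), IsProbabilityMeasure μ' → Kernel.Invariant κ μ' → μ' = μ) ∧
      (∀ ν : Measure (Fin d → ℝ), IsProbabilityMeasure ν →
        ∀ νiter : ℕ → Measure (Fin d → ℝ), νiter 0 = ν →
          (∀ k, νiter (k + 1) = (νiter k).bind κ) →
          ∀ g : BoundedContinuousFunction (Fin d → ℝ) ℝ,
            Tendsto (fun k => ∫ x, g x ∂(νiter k)) atTop (𝓝 (∫ x, g x ∂μ))) := by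
  have : Nonempty (Fin L) := ⟨⟨0, hL⟩⟩
  have hp0 : ∀ ℓ x, 0 ≤ p ℓ x := fun ℓ x ↦ (hp01 ℓ x).1
  choose K hK using hplip
  have hK' : ∀ ℓ, LipschitzWith (∑ i, K i) (p ℓ) := fun ℓ ↦
    (hK ℓ).weaken (Finset.single_le_sum (f := K) (fun _ _ ↦ zero_le) (Finset.mem_univ ℓ))
  obtain ⟨V, s, hs, hs1, hVA, hV, hVcont⟩ := exists_seminorm_mulVec_le A hA
  have hs' : 0 < 1 - s := sub_pos.2 hs1
  set R : ℝ := (∑ ℓ, V (b ℓ)) / (1 - s) with hR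
  have hR0 : 0 ≤ R := div_nonneg (Finset.sum_nonneg fun i _ ↦ apply_nonneg V _) hs'.le
  have hifs := isContractiveIFS_affine (T := A.mulVecLin) (b := b) (R := R) V hδ.le hs hs1 hVA hV
    (fun ℓ ↦ by
      rw [hR, mul_div_cancel₀ _ hs'.ne']
      exact Finset.single_le_sum (f := fun i ↦ V (b i)) (fun i _ ↦ apply_nonneg V _)
        (Finset.mem_univ ℓ)) hK' hpsum hpδ
  refine exists_unique_attractive_of_tendsto_ifsOperator_iterate
    (F := fun ℓ x ↦ A.mulVecLin x + b ℓ) (fun ℓ ↦ ?_) (fun ℓ ↦ (hK ℓ).continuous) hp0 hpsum hκ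
    (B := {x | V x ≤ R}) ?_ ⟨0, by simpa using hR0⟩ hifs.maps_to ?_
  · exact (A.mulVecLin.continuous_of_finiteDimensional).add continuous_const
  · refine Metric.isCompact_of_isClosed_isBounded (isClosed_le hVcont continuous_const) ?_
    exact Metric.isBounded_closedBall.subset fun x (hx : V x ≤ R) ↦
      mem_closedBall_zero_iff.2 ((hV x).trans hx)
  · rintro f ⟨C, hC⟩ ⟨Λ, hΛ⟩
    exact exists_tendsto_ifsOperator_iterate_affine V hδ hs hs1 hVA hV hK' hpsum hpδ hC hΛ
end

section
/- Let κ be a Markov kernel on a standard Borel (Polish) space X, and let μ₁ and μ₂ be two distinct ergodic invariant probability measures for κ. Then μ₁ and μ₂ are mutually singular: there exists a measurable set B ⊆ X with μ₁(B) = 1 and μ₂(B) = 0. -/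
open MeasureTheory ProbabilityTheory

/-- If the finite measures with densities `f₁` and `f₂` are both invariant under a Markov kernel,
then the kernel almost surely does not leave the set where `f₂ < f₁`. -/
theorem ae_kernel_compl_eq_zero_of_invariant_withDensity
    {X : Type*} [MeasurableSpace X] (κ : Kernel X X) [IsMarkovKernel κ]
    (ρ : Measure X) {f₁ f₂ : X → ENNReal} (hf₁ : Measurable f₁) (hf₂ : Measurable f₂)
    [IsFiniteMeasure (ρ.withDensity f₁)] [IsFiniteMeasure (ρ.withDensity f₂)]
    (hinv₁ : Kernel.Invariant κ (ρ.withDensity f₁))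
    (hinv₂ : Kernel.Invariant κ (ρ.withDensity f₂)) :
    ∀ᵐ x ∂ρ, x ∈ {x | f₂ x < f₁ x} → κ x {x | f₂ x < f₁ x}ᶜ = 0 := by
  set S := {x | f₂ x < f₁ x}
  have hS : MeasurableSet S := measurableSet_lt hf₂ hf₁
  have hk : Measurable fun x => κ x S := κ.measurable_coe hS
  have hg : Measurable fun x => κ x Sᶜ := κ.measurable_coe hS.compl
  have flow : ∀ μ : Measure X, IsFiniteMeasure μ → Kernel.Invariant κ μ →
      ∫⁻ x in S, κ x Sᶜ ∂μ = ∫⁻ x in Sᶜ, κ x S ∂μ := by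
    intro μ _ hμ
    have h₁ : ∫⁻ x in S, κ x S ∂μ + ∫⁻ x in Sᶜ, κ x S ∂μ = μ S := by
      rw [lintegral_add_compl _ hS, ← Measure.bind_apply hS κ.aemeasurable, hμ.def]
    have h₂ : ∫⁻ x in S, κ x S ∂μ + ∫⁻ x in S, κ x Sᶜ ∂μ = μ S := by
      rw [← lintegral_add_left hk]
      simp [prob_add_prob_compl hS]
    have h₃ : ∫⁻ x in S, κ x S ∂μ ≠ ⊤ :=
      ne_top_of_le_ne_top (measure_ne_top μ S) (h₁ ▸ le_self_add)
    exact (ENNReal.add_right_inj h₃).1 (h₂.trans h₁.symm)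
  have dens : ∀ (f h : X → ENNReal) (T : Set X), Measurable f → Measurable h → MeasurableSet T →
      ∫⁻ x in T, h x ∂(ρ.withDensity f) = ∫⁻ x in T, f x * h x ∂ρ := by
    intro f h T hf hh hT
    rw [setLIntegral_withDensity_eq_setLIntegral_mul _ hf hh hT]
    rfl
  have e₁ := flow _ inferInstance hinv₁
  have e₂ := flow _ inferInstance hinv₂
  have hfin : ∫⁻ x in S, κ x Sᶜ ∂(ρ.withDensity f₂) ≠ ⊤ := by
    refine ne_top_of_le_ne_top (measure_ne_top (ρ.withDensity f₂) S) ?_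
    calc ∫⁻ x in S, κ x Sᶜ ∂(ρ.withDensity f₂)
        ≤ ∫⁻ _ in S, 1 ∂(ρ.withDensity f₂) := lintegral_mono fun _ => prob_le_one
      _ = ρ.withDensity f₂ S := by simp
  rw [dens _ _ _ hf₁ hg hS, dens _ _ _ hf₁ hk hS.compl] at e₁
  rw [dens _ _ _ hf₂ hg hS, dens _ _ _ hf₂ hk hS.compl] at e₂
  rw [dens _ _ _ hf₂ hg hS] at hfin
  have hle : ∫⁻ x in S, f₁ x * κ x Sᶜ ∂ρ ≤ ∫⁻ x in S, f₂ x * κ x Sᶜ ∂ρ := by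
    rw [e₁, e₂]
    refine setLIntegral_mono (hf₂.mul hk) fun x hx => ?_
    have : f₁ x ≤ f₂ x := not_lt.1 hx
    gcongr
  have hae := ae_eq_of_ae_le_of_lintegral_le (μ := ρ.restrict S)
    (f := fun x => f₂ x * κ x Sᶜ) (g := fun x => f₁ x * κ x Sᶜ)
    ((ae_restrict_iff' hS).2 (.of_forall fun x hx => by
      have : f₂ x ≤ f₁ x := le_of_lt hx
      dsimp only
      gcongr)) hfin (hf₁.mul hg).aemeasurable hle
  filter_upwards [(ae_restrict_iff' hS).1 hae] with x hx hxS
  by_contra h0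
  have hlt : f₂ x < f₁ x := hxS
  exact hlt.ne ((ENNReal.mul_left_inj h0 (measure_ne_top _ _)).1 (hx hxS))

/-- A probability measure dominated by another one on a set of full measure is equal to it. -/
theorem eq_of_restrict_le_of_measure_compl_eq_zero
    {X : Type*} [MeasurableSpace X] {μ ν : Measure X} [IsProbabilityMeasure μ]
    [IsProbabilityMeasure ν] {T : Set X} (h0 : μ Tᶜ = 0)
    (h : μ.restrict T ≤ ν.restrict T) : μ = ν := by
  rw [Measure.restrict_eq_self_of_ae_mem (measure_eq_zero_iff_ae_notMem.1 h0 |>.mono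
    fun _ hx => not_not.1 hx)] at h
  exact Measure.eq_of_le_of_isProbabilityMeasure (h.trans Measure.restrict_le_self)

/-- **Distinct ergodic invariant measures are mutually singular** (consequence C2 in the
paper's Proposition 1). On a standard Borel space, if `μ₁ ≠ μ₂` are ergodic invariant
probability measures of a Markov kernel `κ`, then there is a measurable set `B` with
`μ₁ B = 1` and `μ₂ B = 0`. -/
theorem distinct_ergodic_invariant_measures_mutually_singular
    {X : Type*} [MeasurableSpace X] [StandardBorelSpace X]
    (κ : Kernel X X) [IsMarkovKernel κ]
    (μ₁ μ₂ : Measure X) [IsProbabilityMeasure μ₁] [IsProbabilityMeasure μ₂]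
    (hinv₁ : Kernel.Invariant κ μ₁) (hinv₂ : Kernel.Invariant κ μ₂)
    (herg₁ : ∀ S : Set X, MeasurableSet S → (∀ᵐ x ∂μ₁, x ∈ S → κ x S = 1) →
      μ₁ S = 0 ∨ μ₁ S = 1)
    (herg₂ : ∀ S : Set X, MeasurableSet S → (∀ᵐ x ∂μ₂, x ∈ S → κ x S = 1) →
      μ₂ S = 0 ∨ μ₂ S = 1)
    (hne : μ₁ ≠ μ₂) :
    ∃ B : Set X, MeasurableSet B ∧ μ₁ B = 1 ∧ μ₂ B = 0 := by
  set ρ := μ₁ + μ₂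
  have hac₁ : μ₁ ≪ ρ := Measure.absolutelyContinuous_of_le (Measure.le_add_right le_rfl)
  have hac₂ : μ₂ ≪ ρ := Measure.absolutelyContinuous_of_le (Measure.le_add_left le_rfl)
  set f₁ := μ₁.rnDeriv ρ
  set f₂ := μ₂.rnDeriv ρ
  have hf₁ : Measurable f₁ := Measure.measurable_rnDeriv _ _
  have hf₂ : Measurable f₂ := Measure.measurable_rnDeriv _ _
  have hd₁ : ρ.withDensity f₁ = μ₁ := Measure.withDensity_rnDeriv_eq _ _ hac₁
  have hd₂ : ρ.withDensity f₂ = μ₂ := Measure.withDensity_rnDeriv_eq _ _ hac₂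
  have : IsFiniteMeasure (ρ.withDensity f₁) := hd₁ ▸ inferInstance
  have : IsFiniteMeasure (ρ.withDensity f₂) := hd₂ ▸ inferInstance
  have hstay := ae_kernel_compl_eq_zero_of_invariant_withDensity κ ρ hf₁ hf₂
    (hd₁.symm ▸ hinv₁) (hd₂.symm ▸ hinv₂)
  set S := {x | f₂ x < f₁ x}
  have hS : MeasurableSet S := measurableSet_lt hf₂ hf₁
  have habs : ∀ᵐ x ∂ρ, x ∈ S → κ x S = 1 :=
    hstay.mono fun x hx hxS => (prob_compl_eq_zero_iff hS).1 (hx hxS)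
  have hle₂ : μ₂.restrict S ≤ μ₁.restrict S := by
    rw [← hd₁, ← hd₂, restrict_withDensity hS, restrict_withDensity hS]
    exact withDensity_mono ((ae_restrict_iff' hS).2 (.of_forall fun x hx => le_of_lt hx))
  have hle₁ : μ₁.restrict Sᶜ ≤ μ₂.restrict Sᶜ := by
    rw [← hd₁, ← hd₂, restrict_withDensity hS.compl, restrict_withDensity hS.compl]
    exact withDensity_mono ((ae_restrict_iff' hS.compl).2 (.of_forall fun x hx => not_lt.1 hx))
  refine ⟨S, hS, (herg₁ S hS (hac₁.ae_le habs)).resolve_left fun h => hne ?_,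
    (herg₂ S hS (hac₂.ae_le habs)).resolve_right fun h => hne ?_⟩
  · exact eq_of_restrict_le_of_measure_compl_eq_zero (by rwa [compl_compl]) hle₁
  · exact (eq_of_restrict_le_of_measure_compl_eq_zero
      ((prob_compl_eq_zero_iff hS).2 h) hle₂).symm
end

section
/- Let κ be a Markov kernel on a standard Borel (Polish) space X and let μ be an invariant probability measure for κ. Then μ is ergodic if and only if μ is extremal among invariant probability measures: there do not exist t ∈ (0,1) and invariant probability measures μ₁ ≠ μ₂ for κ with μ = t·μ₁ + (1−t)·μ₂. -/
open MeasureTheory ProbabilityTheory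

section

variable {X : Type*} [MeasurableSpace X] {κ : Kernel X X} {μ : Measure X}

lemma lintegral_kernel_apply_of_invariant (h : Kernel.Invariant κ μ) {A : Set X}
    (hA : MeasurableSet A) : ∫⁻ x, κ x A ∂μ = μ A := by
  conv_rhs => rw [← h.def, Measure.bind_apply hA κ.measurable.aemeasurable]

lemma invariant_smul_measure (h : Kernel.Invariant κ μ) (c : ENNReal) :
    Kernel.Invariant κ (c • μ) := by
  refine Measure.ext fun A hA => ?_
  rw [Measure.bind_apply hA κ.measurable.aemeasurable, lintegral_smul_measure,
    lintegral_kernel_apply_of_invariant h hA, Measure.smul_apply]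

variable [IsMarkovKernel κ]

/-- If almost every point of `S` stays in `S`, almost every point outside `S` stays outside. -/
lemma ae_compl_absorbing_of_invariant [IsFiniteMeasure μ] (h : Kernel.Invariant κ μ) {S : Set X}
    (hS : MeasurableSet S) (habs : ∀ᵐ x ∂μ, x ∈ S → κ x S = 1) :
    ∀ᵐ x ∂μ, x ∈ Sᶜ → κ x Sᶜ = 1 := by
  have hmass := lintegral_kernel_apply_of_invariant h hS
  rw [← lintegral_add_compl _ hS, setLIntegral_congr_fun_ae hS habs, setLIntegral_one] at hmass
  have hzero : ∫⁻ x in Sᶜ, κ x S ∂μ = 0 :=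
    (ENNReal.add_right_inj (measure_ne_top μ S)).1 (hmass.trans (add_zero _).symm)
  rw [lintegral_eq_zero_iff (κ.measurable_coe hS), Filter.EventuallyEq,
    ae_restrict_iff' hS.compl] at hzero
  filter_upwards [hzero] with x hx hxS
  exact (prob_compl_eq_one_iff hS).2 (hx hxS)

lemma invariant_restrict_of_absorbing [IsFiniteMeasure μ] (h : Kernel.Invariant κ μ) {S : Set X}
    (hS : MeasurableSet S) (habs : ∀ᵐ x ∂μ, x ∈ S → κ x S = 1) :
    Kernel.Invariant κ (μ.restrict S) := by
  refine Measure.ext fun A hA => ?_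
  rw [Measure.bind_apply hA κ.measurable.aemeasurable, Measure.restrict_apply hA,
    ← lintegral_kernel_apply_of_invariant h (hA.inter hS),
    ← lintegral_add_compl (fun x => κ x (A ∩ S)) hS]
  have hcompl : ∫⁻ x in Sᶜ, κ x (A ∩ S) ∂μ = 0 := by
    rw [← lintegral_zero (μ := μ.restrict Sᶜ)]
    refine setLIntegral_congr_fun_ae hS.compl ?_
    filter_upwards [ae_compl_absorbing_of_invariant h hS habs] with x hx hxS
    exact measure_mono_null Set.inter_subset_right ((prob_compl_eq_one_iff hS).1 (hx hxS))
  rw [hcompl, add_zero]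
  refine setLIntegral_congr_fun_ae hS ?_
  filter_upwards [habs] with x hx hxS
  exact (measure_inter_conull ((prob_compl_eq_zero_iff hS).2 (hx hxS))).symm

lemma integral_kernel_sub_indicator_eq_zero [IsFiniteMeasure μ] (h : Kernel.Invariant κ μ)
    {S : Set X} (hS : MeasurableSet S) :
    ∫ x, ((κ x).real S - S.indicator 1 x) ∂μ = 0 := by
  have hκ : Integrable (fun x => (κ x).real S) μ :=
    .of_bound (κ.measurable_coe hS).ennreal_toReal.aestronglyMeasurable 1 (.of_forall fun x => by
      rw [Real.norm_of_nonneg measureReal_nonneg]; exact measureReal_le_one)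
  have hind : Integrable (S.indicator (1 : X → ℝ)) μ := (integrable_const 1).indicator hS
  rw [integral_sub hκ hind, integral_indicator_one hS]
  simp only [Measure.real]
  rw [integral_toReal (κ.measurable_coe hS).aemeasurable (.of_forall fun x => measure_lt_top _ _),
    lintegral_kernel_apply_of_invariant h hS, sub_self]

/-- The set where one invariant measure has larger density than another is absorbing. -/
lemma ae_absorbing_rnDeriv_lt [IsFiniteMeasure μ] {μ₁ μ₂ : Measure X} [IsFiniteMeasure μ₁]
    [IsFiniteMeasure μ₂] (h₁ : Kernel.Invariant κ μ₁) (h₂ : Kernel.Invariant κ μ₂)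
    (hμ₁ : μ₁ ≪ μ) (hμ₂ : μ₂ ≪ μ) :
    ∀ᵐ x ∂μ, x ∈ {x | (μ₂.rnDeriv μ x).toReal < (μ₁.rnDeriv μ x).toReal} →
      κ x {x | (μ₂.rnDeriv μ x).toReal < (μ₁.rnDeriv μ x).toReal} = 1 := by
  set f := fun x => (μ₁.rnDeriv μ x).toReal
  set g := fun x => (μ₂.rnDeriv μ x).toReal
  change ∀ᵐ x ∂μ, x ∈ {x | g x < f x} → κ x {x | g x < f x} = 1
  set S := {x | g x < f x}
  have hS : MeasurableSet S := measurableSet_lt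
    (Measure.measurable_rnDeriv _ _).ennreal_toReal (Measure.measurable_rnDeriv _ _).ennreal_toReal
  set d := fun x => (κ x).real S - S.indicator 1 x with hd
  have hdm : Measurable d :=
    (κ.measurable_coe hS).ennreal_toReal.sub (measurable_one.indicator hS)
  have hdb : ∀ x, ‖d x‖ ≤ 1 := fun x => by
    have h0 : 0 ≤ (κ x).real S := measureReal_nonneg
    have h1 : (κ x).real S ≤ 1 := measureReal_le_one
    rw [Real.norm_eq_abs, abs_le]
    by_cases hx : x ∈ S <;> simp [hd, hx] <;> linarith
  have hdi : ∀ ν : Measure X, IsFiniteMeasure ν → Integrable d ν := fun ν _ =>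
    .of_bound hdm.aestronglyMeasurable 1 (.of_forall hdb)
  have hfi : Integrable (fun x => f x • d x) μ := (integrable_rnDeriv_smul_iff hμ₁).2 (hdi μ₁ ‹_›)
  have hgi : Integrable (fun x => g x • d x) μ := (integrable_rnDeriv_smul_iff hμ₂).2 (hdi μ₂ ‹_›)
  have hint : ∫ x, (g x • d x - f x • d x) ∂μ = 0 := by
    rw [integral_sub hgi hfi, integral_rnDeriv_smul hμ₁, integral_rnDeriv_smul hμ₂,
      integral_kernel_sub_indicator_eq_zero h₁ hS, integral_kernel_sub_indicator_eq_zero h₂ hS,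
      sub_self]
  have hnonneg : ∀ x, 0 ≤ g x • d x - f x • d x := fun x => by
    have h0 : 0 ≤ (κ x).real S := measureReal_nonneg
    have h1 : (κ x).real S ≤ 1 := measureReal_le_one
    by_cases hx : x ∈ S
    · have hlt : g x < f x := hx
      simp only [hd, Set.indicator_of_mem hx, Pi.one_apply, smul_eq_mul]
      nlinarith
    · have hle : f x ≤ g x := not_lt.1 hx
      simp only [hd, Set.indicator_of_notMem hx, smul_eq_mul]
      nlinarith
  rw [integral_eq_zero_iff_of_nonneg hnonneg (hgi.sub hfi)] at hint
  filter_upwards [hint] with x hx hxS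
  have hlt : g x < f x := hxS
  have hprod : (g x - f x) * d x = 0 := by
    simpa only [smul_eq_mul, ← sub_mul, Pi.zero_apply] using hx
  have hdx : d x = 0 := (mul_eq_zero.1 hprod).resolve_left (sub_ne_zero.2 hlt.ne)
  have hreal : (κ x).real S = 1 := by
    simpa [hd, Set.indicator_of_mem hxS, sub_eq_zero] using hdx
  exact (ENNReal.toReal_eq_one_iff _).1 hreal

end

/-- Domination of densities passes to the measures. -/
lemma le_of_ae_toReal_rnDeriv_le {X : Type*} [MeasurableSpace X] {μ μ₁ μ₂ : Measure X}
    [IsFiniteMeasure μ] [IsFiniteMeasure μ₁] [IsFiniteMeasure μ₂] (hμ₁ : μ₁ ≪ μ) (hμ₂ : μ₂ ≪ μ)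
    (h : ∀ᵐ x ∂μ, (μ₁.rnDeriv μ x).toReal ≤ (μ₂.rnDeriv μ x).toReal) : μ₁ ≤ μ₂ := by
  rw [← Measure.withDensity_rnDeriv_eq _ _ hμ₁, ← Measure.withDensity_rnDeriv_eq _ _ hμ₂]
  refine withDensity_mono ?_
  filter_upwards [h, μ₁.rnDeriv_lt_top μ, μ₂.rnDeriv_lt_top μ] with x hx h1 h2
  exact (ENNReal.toReal_le_toReal h1.ne h2.ne).1 hx

/-- **Ergodicity is equivalent to extremality among invariant measures** (E1 ⇔ E3 in the
paper's Proposition 1). On a standard Borel space, an invariant probability measure `μ` of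
a Markov kernel `κ` is ergodic if and only if it cannot be written as `t•μ₁ + (1-t)•μ₂`
with `t ∈ (0,1)` and distinct invariant probability measures `μ₁ ≠ μ₂`. -/
theorem ergodic_iff_extremal_invariant_measure
    {X : Type*} [MeasurableSpace X] [StandardBorelSpace X]
    (κ : Kernel X X) [IsMarkovKernel κ]
    (μ : Measure X) [IsProbabilityMeasure μ] (hinv : Kernel.Invariant κ μ) :
    (∀ S : Set X, MeasurableSet S → (∀ᵐ x ∂μ, x ∈ S → κ x S = 1) →
        μ S = 0 ∨ μ S = 1) ↔
      ¬ ∃ t : ℝ, t ∈ Set.Ioo (0 : ℝ) 1 ∧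
        ∃ μ₁ μ₂ : Measure X, IsProbabilityMeasure μ₁ ∧ IsProbabilityMeasure μ₂ ∧
          Kernel.Invariant κ μ₁ ∧ Kernel.Invariant κ μ₂ ∧ μ₁ ≠ μ₂ ∧
          μ = ENNReal.ofReal t • μ₁ + ENNReal.ofReal (1 - t) • μ₂ := by
  constructor
  · rintro herg ⟨t, ⟨ht0, ht1⟩, μ₁, μ₂, _, _, h₁, h₂, hne, hμ⟩
    have hμ₁ : μ₁ ≪ μ := by
      rw [hμ]
      exact (Measure.absolutelyContinuous_smul (ENNReal.ofReal_pos.2 ht0).ne').trans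
        (Measure.le_add_right le_rfl).absolutelyContinuous
    have hμ₂ : μ₂ ≪ μ := by
      rw [hμ]
      exact (Measure.absolutelyContinuous_smul (ENNReal.ofReal_pos.2 (sub_pos.2 ht1)).ne').trans
        (Measure.le_add_left le_rfl).absolutelyContinuous
    have hS : MeasurableSet {x | (μ₂.rnDeriv μ x).toReal < (μ₁.rnDeriv μ x).toReal} :=
      measurableSet_lt (Measure.measurable_rnDeriv _ _).ennreal_toReal
        (Measure.measurable_rnDeriv _ _).ennreal_toReal
    rcases herg _ hS (ae_absorbing_rnDeriv_lt h₁ h₂ hμ₁ hμ₂) with h | h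
    · refine hne (Measure.eq_of_le_of_isProbabilityMeasure
        (le_of_ae_toReal_rnDeriv_le hμ₁ hμ₂ ?_))
      filter_upwards [measure_eq_zero_iff_ae_notMem.1 h] with x hx
      exact not_lt.1 hx
    · refine hne (Measure.eq_of_le_of_isProbabilityMeasure
        (le_of_ae_toReal_rnDeriv_le hμ₂ hμ₁ ?_)).symm
      filter_upwards [(mem_ae_iff_prob_eq_one hS).2 h] with x hx
      exact le_of_lt hx
  · intro hext S hS habs
    by_contra! hμS
    obtain ⟨h0, h1⟩ := hμS
    have hc0 : μ Sᶜ ≠ 0 := fun h => h1 ((prob_compl_eq_zero_iff hS).1 h)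
    have hpos : 0 < μ.real S := ENNReal.toReal_pos h0 (measure_ne_top _ _)
    have hcpos : 0 < μ.real Sᶜ := ENNReal.toReal_pos hc0 (measure_ne_top _ _)
    have hadd : 1 - μ.real S = μ.real Sᶜ := (probReal_compl_eq_one_sub hS).symm
    refine hext ⟨μ.real S, ⟨hpos, by linarith⟩, (μ S)⁻¹ • μ.restrict S,
      (μ Sᶜ)⁻¹ • μ.restrict Sᶜ, cond_isProbabilityMeasure h0, cond_isProbabilityMeasure hc0,
      invariant_smul_measure (invariant_restrict_of_absorbing hinv hS habs) _,
      invariant_smul_measure (invariant_restrict_of_absorbing hinv hS.compl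
        (ae_compl_absorbing_of_invariant hinv hS habs)) _, fun heq => ?_, ?_⟩
    · have := congrArg (fun ν : Measure X => ν S) heq
      simp [Measure.restrict_apply hS, h0, ENNReal.inv_mul_cancel] at this
    · rw [hadd, ofReal_measureReal, ofReal_measureReal, smul_smul, smul_smul,
        ENNReal.mul_inv_cancel h0 (measure_ne_top _ _),
        ENNReal.mul_inv_cancel hc0 (measure_ne_top _ _), one_smul, one_smul,
        Measure.restrict_add_restrict_compl hS]
end

section
/- Let κ be a Markov kernel on a Polish metric space X, and let μ₁ and μ₂ be ergodic invariant probability measures for κ. Then μ₁ = μ₂ if and only if there exists an asymptotic coupling of the path measures P_{μ₁} and P_{μ₂}: a probability measure Γ on X^ℕ × X^ℕ whose two marginals are P_{μ₁} and P_{μ₂} and which gives full measure to the set H of pairs of sequences (x₁, x₂) with dist(x₁(k), x₂(k)) → 0 as k → ∞. -/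
open MeasureTheory ProbabilityTheory Filter Topology

/-- The finite-dimensional distributions of the time-homogeneous Markov chain with
transition kernel `κ` and initial distribution `lam`: `finiteDimLaw κ lam n` is the joint
law of the first `n+1` states. -/
noncomputable def finiteDimLaw {X : Type*} [MeasurableSpace X]
    (κ : Kernel X X) (lam : Measure X) : (n : ℕ) → Measure (Fin (n + 1) → X)
  | 0 => lam.map (fun x _ => x)
  | n + 1 => (finiteDimLaw κ lam n).bind
      (fun xs => (κ (xs (Fin.last n))).map (fun y => Fin.snoc xs y))

/-- `P` is the path measure (on the path space `ℕ → X` with the product σ-algebra) of the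
time-homogeneous Markov chain with transition kernel `κ` and initial distribution `lam`,
i.e. all its finite-dimensional marginals are the ones prescribed by `κ` and `lam`. -/
def IsPathMeasure {X : Type*} [MeasurableSpace X] (κ : Kernel X X) (lam : Measure X)
    (P : Measure (ℕ → X)) : Prop :=
  ∀ n : ℕ, P.map (fun ω (i : Fin (n + 1)) => ω (i : ℕ)) = finiteDimLaw κ lam n

theorem measurable_finSnoc {X : Type*} [MeasurableSpace X] (n : ℕ) :
    Measurable (fun p : (Fin n → X) × X => (Fin.snoc p.1 p.2 : Fin (n + 1) → X)) := by
  refine measurable_pi_iff.2 fun i => ?_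
  refine Fin.lastCases ?_ (fun j => ?_) i
  · simpa using measurable_snd
  · simp only [Fin.snoc_castSucc]
    fun_prop

theorem measurable_kernel_map_snoc {X : Type*} [MeasurableSpace X] (κ : Kernel X X)
    [IsMarkovKernel κ] (n : ℕ) :
    Measurable (fun xs : Fin (n + 1) → X =>
      (κ (xs (Fin.last n))).map (fun y => (Fin.snoc xs y : Fin (n + 2) → X))) := by
  refine Measure.measurable_of_measurable_coe _ fun s hs => ?_
  have hsnoc := measurable_finSnoc (X := X) (n + 1)
  have hsnoc' (xs : Fin (n + 1) → X) :
      Measurable (fun y => (Fin.snoc xs y : Fin (n + 2) → X)) := hsnoc.comp measurable_prodMk_left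
  have heq : ∀ xs : Fin (n + 1) → X,
      (κ (xs (Fin.last n))).map (fun y => (Fin.snoc xs y : Fin (n + 2) → X)) s =
        (κ.comap _ (measurable_pi_apply (Fin.last n))) xs
          (Prod.mk xs ⁻¹' ((fun p : (Fin (n + 1) → X) × X =>
            (Fin.snoc p.1 p.2 : Fin (n + 2) → X)) ⁻¹' s)) := fun xs => by
    rw [Measure.map_apply (hsnoc' xs) hs]
    rfl
  simp_rw [heq]
  exact Kernel.measurable_kernel_prodMk_left (hsnoc hs)

/-- Started from an invariant measure, the chain has that measure as its law at each time. -/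
theorem finiteDimLaw_map_last {X : Type*} [MeasurableSpace X] {κ : Kernel X X}
    [IsMarkovKernel κ] {μ : Measure X} (hinv : Kernel.Invariant κ μ) (n : ℕ) :
    (finiteDimLaw κ μ n).map (fun xs => xs (Fin.last n)) = μ := by
  induction n with
  | zero =>
    rw [finiteDimLaw, Measure.map_map (measurable_pi_apply _) (by fun_prop)]
    exact Measure.map_id
  | succ n ih =>
    ext s hs
    have hlast : Measurable (fun xs : Fin (n + 2) → X => xs (Fin.last (n + 1))) :=
      measurable_pi_apply _
    have hsnoc (xs : Fin (n + 1) → X) :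
        Measurable (fun y => (Fin.snoc xs y : Fin (n + 2) → X)) :=
      (measurable_finSnoc (n + 1)).comp measurable_prodMk_left
    rw [Measure.map_apply hlast hs, finiteDimLaw,
      Measure.bind_apply (hlast hs) (measurable_kernel_map_snoc κ n).aemeasurable]
    have heq : ∀ xs : Fin (n + 1) → X,
        (κ (xs (Fin.last n))).map (fun y => (Fin.snoc xs y : Fin (n + 2) → X))
          ((fun xs => xs (Fin.last (n + 1))) ⁻¹' s) = κ (xs (Fin.last n)) s := fun xs => by
      rw [Measure.map_apply (hsnoc xs) (hlast hs)]
      congr 1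
      ext y
      simp
    simp_rw [heq]
    rw [← lintegral_map (κ.measurable_coe hs) (measurable_pi_apply _), ih,
      ← Measure.bind_apply hs κ.aemeasurable, hinv.def]

theorem IsPathMeasure.map_eval {X : Type*} [MeasurableSpace X] {κ : Kernel X X}
    [IsMarkovKernel κ] {μ : Measure X} {P : Measure (ℕ → X)} (hP : IsPathMeasure κ μ P)
    (hinv : Kernel.Invariant κ μ) (n : ℕ) : P.map (fun ω => ω n) = μ := by
  rw [← finiteDimLaw_map_last hinv n, ← hP n,
    Measure.map_map (measurable_pi_apply _) (by fun_prop)]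
  rfl

theorem IsPathMeasure.unique {X : Type*} [MeasurableSpace X] {κ : Kernel X X}
    {μ : Measure X} {P Q : Measure (ℕ → X)} [IsFiniteMeasure P]
    (hP : IsPathMeasure κ μ P) (hQ : IsPathMeasure κ μ Q) : P = Q := by
  refine IsProjectiveLimit.unique (P := fun I : Finset ℕ => P.map I.restrict)
    (fun _ => rfl) (fun I => ?_)
  obtain ⟨N, hN⟩ := I.exists_nat_subset_range
  have hlt : ∀ i : I, (i : ℕ) < N + 1 := fun i =>
    (Finset.mem_range.1 (hN i.2)).trans (Nat.lt_succ_self N)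
  have hmap : ∀ R : Measure (ℕ → X), R.map I.restrict =
      (R.map (fun ω (i : Fin (N + 1)) => ω (i : ℕ))).map (fun v (i : I) => v ⟨i, hlt i⟩) :=
    fun R => by
      rw [Measure.map_map (by fun_prop) (by fun_prop)]
      rfl
  change Q.map I.restrict = P.map I.restrict
  rw [hmap, hmap, hP N, hQ N]

/-- Two laws carried by sequences of random variables whose distance tends to `0` almost surely
coincide. -/
theorem eq_of_map_eq_of_ae_tendsto_dist {Ω X : Type*} [MeasurableSpace Ω] [MetricSpace X]
    [MeasurableSpace X] [BorelSpace X] {Γ : Measure Ω} [IsProbabilityMeasure Γ]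
    {μ ν : Measure X} [IsProbabilityMeasure μ] [IsProbabilityMeasure ν] {U V : ℕ → Ω → X}
    (hU : ∀ k, Measurable (U k)) (hV : ∀ k, Measurable (V k))
    (hUμ : ∀ k, Γ.map (U k) = μ) (hVν : ∀ k, Γ.map (V k) = ν)
    (h : ∀ᵐ ω ∂Γ, Tendsto (fun k => dist (U k ω) (V k ω)) atTop (𝓝 0)) : μ = ν := by
  let μ' : ProbabilityMeasure X := ⟨μ, inferInstance⟩
  let ν' : ProbabilityMeasure X := ⟨ν, inferInstance⟩
  have key : Tendsto (fun _ : ℕ => μ') atTop (𝓝 ν') := by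
    refine tendsto_iff_forall_lipschitz_integral_tendsto.2 ?_
    rintro f ⟨C, hC⟩ ⟨L, hL⟩
    have hf : Measurable f := hL.continuous.measurable
    obtain ⟨x₀⟩ : Nonempty X := nonempty_of_isProbabilityMeasure μ
    have hint : ∀ {W : Ω → X}, Measurable W → Integrable (fun ω => f (W ω)) Γ := fun {W} hW =>
      Integrable.of_bound (hf.comp hW).aestronglyMeasurable (C + ‖f x₀‖)
        (ae_of_all _ fun ω => by
          have h₁ := hC (W ω) x₀
          rw [dist_eq_norm] at h₁
          linarith [norm_le_norm_sub_add (f (W ω)) (f x₀)])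
    have hlim : Tendsto (fun k => ∫ ω, (f (U k ω) - f (V k ω)) ∂Γ) atTop (𝓝 0) := by
      rw [← integral_zero Ω ℝ (μ := Γ)]
      refine tendsto_integral_of_dominated_convergence (fun _ => C)
        (fun k => ((hint (hU k)).sub (hint (hV k))).aestronglyMeasurable) (integrable_const C)
        (fun k => ae_of_all _ fun ω => ?_) ?_
      · rw [← dist_eq_norm]
        exact hC _ _
      · filter_upwards [h] with ω hω
        refine squeeze_zero_norm (a := fun k => L * dist (U k ω) (V k ω)) (fun k => ?_)
          (by simpa using hω.const_mul (L : ℝ))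
        rw [← dist_eq_norm]
        exact hL.dist_le_mul _ _
    have hconst : ∀ k, ∫ ω, (f (U k ω) - f (V k ω)) ∂Γ = ∫ x, f x ∂μ - ∫ x, f x ∂ν :=
      fun k => by
        rw [integral_sub (hint (hU k)) (hint (hV k)), ← hUμ k, ← hVν k,
          integral_map (hU k).aemeasurable hf.aestronglyMeasurable,
          integral_map (hV k).aemeasurable hf.aestronglyMeasurable]
    simp_rw [hconst] at hlim
    have hzero := tendsto_nhds_unique tendsto_const_nhds hlim
    change Tendsto (fun _ : ℕ => ∫ x, f x ∂μ) atTop (𝓝 (∫ x, f x ∂ν))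
    rw [sub_eq_zero.1 hzero]
    exact tendsto_const_nhds
  have heq : μ' = ν' := tendsto_nhds_unique tendsto_const_nhds key
  exact congrArg Subtype.val heq

/-- **Asymptotic-coupling criterion for equality of ergodic invariant measures**
(Theorem 3 in the paper, after Hairer–Mattingly–Scheutzow). For a Markov kernel `κ` on a
Polish metric space with ergodic invariant probability measures `μ₁, μ₂` and associated
path measures `P₁, P₂`: `μ₁ = μ₂` iff there is an asymptotic coupling of `P₁` and `P₂`,
i.e. a probability measure `Γ` on the product of path spaces with marginals `P₁, P₂`
giving full measure to pairs of trajectories with `dist (x₁ k) (x₂ k) → 0`. -/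
theorem ergodic_invariant_measures_eq_iff_asymptotic_coupling
    {X : Type*} [MetricSpace X] [CompleteSpace X] [TopologicalSpace.SeparableSpace X]
    [MeasurableSpace X] [BorelSpace X]
    (κ : Kernel X X) [IsMarkovKernel κ]
    (μ₁ μ₂ : Measure X) [IsProbabilityMeasure μ₁] [IsProbabilityMeasure μ₂]
    (hinv₁ : Kernel.Invariant κ μ₁) (hinv₂ : Kernel.Invariant κ μ₂)
    (herg₁ : ∀ S : Set X, MeasurableSet S → (∀ᵐ x ∂μ₁, x ∈ S → κ x S = 1) →
      μ₁ S = 0 ∨ μ₁ S = 1)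
    (herg₂ : ∀ S : Set X, MeasurableSet S → (∀ᵐ x ∂μ₂, x ∈ S → κ x S = 1) →
      μ₂ S = 0 ∨ μ₂ S = 1)
    (P₁ P₂ : Measure (ℕ → X)) [IsProbabilityMeasure P₁] [IsProbabilityMeasure P₂]
    (hP₁ : IsPathMeasure κ μ₁ P₁) (hP₂ : IsPathMeasure κ μ₂ P₂) :
    μ₁ = μ₂ ↔
      ∃ Γ : Measure ((ℕ → X) × (ℕ → X)), IsProbabilityMeasure Γ ∧
        Γ.map Prod.fst = P₁ ∧ Γ.map Prod.snd = P₂ ∧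
        Γ {p | Tendsto (fun k => dist (p.1 k) (p.2 k)) atTop (𝓝 0)} = 1 := by
  have : SecondCountableTopology X := UniformSpace.secondCountable_of_separable X
  have hH : MeasurableSet {p : (ℕ → X) × (ℕ → X) |
      Tendsto (fun k => dist (p.1 k) (p.2 k)) atTop (𝓝 0)} :=
    measurableSet_tendsto (𝓝 0) fun k => by fun_prop
  constructor
  · rintro rfl
    obtain rfl := hP₁.unique hP₂
    have hdiag : Measurable (fun ω : ℕ → X => (ω, ω)) := by fun_prop
    have : IsProbabilityMeasure (P₁.map fun ω => (ω, ω)) :=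
      Measure.isProbabilityMeasure_map hdiag.aemeasurable
    refine ⟨P₁.map fun ω => (ω, ω), this, ?_, ?_, ?_⟩
    · rw [Measure.map_map measurable_fst hdiag]
      exact Measure.map_id
    · rw [Measure.map_map measurable_snd hdiag]
      exact Measure.map_id
    · rw [Measure.map_apply hdiag hH]
      simp
  · rintro ⟨Γ, hΓ, rfl, rfl, hΓH⟩
    refine eq_of_map_eq_of_ae_tendsto_dist (Γ := Γ) (U := fun k p => p.1 k)
      (V := fun k p => p.2 k) (by fun_prop) (by fun_prop) (fun k => ?_) (fun k => ?_)
      ((mem_ae_iff_prob_eq_one hH).2 hΓH)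
    · rw [← hP₁.map_eval hinv₁ k, Measure.map_map (measurable_pi_apply k) measurable_fst]
      rfl
    · rw [← hP₂.map_eval hinv₂ k, Measure.map_map (measurable_pi_apply k) measurable_snd]
      rfl
end
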